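/- Let Q be a digraph with a source (or sink) vertex a, and let Q' be the digraph obtained from Q by deleting a and all connections touching a. Then the Hecke–Kiselman monoid H_Q is finite if and only if H_{Q'} is finite. -/

import Mathlib

open FreeMonoid

structure HKGraph (V : Type) where
  edge : V → V → Prop
  arrow : V → V → Prop
  edge_symm : ∀ i j, edge i j → edge j i
  edge_irrefl : ∀ i, ¬ edge i i
  arrow_irrefl : ∀ i, ¬ arrow i i
  edge_not_arrow : ∀ i j, edge i j → ¬ arrow i j
  arrow_asymm : ∀ i j, arrow i j → ¬ arrow j i

namespace HKGraph
variable {V : Type}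

/-- The defining relations of the Hecke–Kiselman monoid of a digraph. -/
inductive Rel (Q : HKGraph V) : FreeMonoid V → FreeMonoid V → Prop
  | idem (i : V) : Rel Q (of i * of i) (of i)
  | comm (i j : V) : i ≠ j → ¬ Q.edge i j → ¬ Q.arrow i j → ¬ Q.arrow j i →
      Rel Q (of i * of j) (of j * of i)
  | braid (i j : V) : Q.edge i j → Rel Q (of i * of j * of i) (of j * of i * of j)
  | arrow_left (i j : V) : Q.arrow i j → Rel Q (of i * of j) (of i * of j * of i)
  | arrow_right (i j : V) : Q.arrow i j → Rel Q (of i * of j) (of j * of i * of j)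

/-- The Hecke–Kiselman monoid of a digraph. -/
abbrev HK (Q : HKGraph V) : Type := (conGen Q.Rel).Quotient

/-- The idempotent generator of `HK Q` attached to a vertex. -/
def gen (Q : HKGraph V) (i : V) : HK Q := Con.mk' _ (of i)

end HKGraph

namespace HKGraph

/-- The digraph obtained by deleting a vertex and all connections touching it. -/
def delete {V : Type} (Q : HKGraph V) (a : V) : HKGraph {v : V // v ≠ a} where
  edge := fun i j => Q.edge i.1 j.1
  arrow := fun i j => Q.arrow i.1 j.1
  edge_symm := fun i j h => Q.edge_symm i.1 j.1 h
  edge_irrefl := fun i => Q.edge_irrefl i.1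
  arrow_irrefl := fun i => Q.arrow_irrefl i.1
  edge_not_arrow := fun i j h => Q.edge_not_arrow i.1 j.1 h
  arrow_asymm := fun i j h => Q.arrow_asymm i.1 j.1 h

end HKGraph

namespace HKGraph

theorem mk_eq_mk {V : Type} (Q : HKGraph V) {x y : FreeMonoid V} (h : Q.Rel x y) :
    Con.mk' (conGen Q.Rel) x = Con.mk' (conGen Q.Rel) y :=
  (Con.eq _).2 (ConGen.Rel.of _ _ h)

theorem gen_mul_self {V : Type} (Q : HKGraph V) (i : V) : Q.gen i * Q.gen i = Q.gen i :=
  Q.mk_eq_mk (Rel.idem i)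

theorem gen_comm {V : Type} (Q : HKGraph V) {i j : V} (hij : i ≠ j) (he : ¬ Q.edge i j)
    (h₁ : ¬ Q.arrow i j) (h₂ : ¬ Q.arrow j i) : Q.gen i * Q.gen j = Q.gen j * Q.gen i :=
  Q.mk_eq_mk (Rel.comm i j hij he h₁ h₂)

theorem gen_braid {V : Type} (Q : HKGraph V) {i j : V} (h : Q.edge i j) :
    Q.gen i * Q.gen j * Q.gen i = Q.gen j * Q.gen i * Q.gen j :=
  Q.mk_eq_mk (Rel.braid i j h)

theorem gen_arrow_left {V : Type} (Q : HKGraph V) {i j : V} (h : Q.arrow i j) :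
    Q.gen i * Q.gen j = Q.gen i * Q.gen j * Q.gen i :=
  Q.mk_eq_mk (Rel.arrow_left i j h)

theorem gen_arrow_right {V : Type} (Q : HKGraph V) {i j : V} (h : Q.arrow i j) :
    Q.gen i * Q.gen j = Q.gen j * Q.gen i * Q.gen j :=
  Q.mk_eq_mk (Rel.arrow_right i j h)

/-- A map on vertices respecting the defining relations extends to the monoid. -/
def lift {V M : Type} [Monoid M] (Q : HKGraph V) (f : V → M)
    (hf : ∀ x y, Q.Rel x y → FreeMonoid.lift f x = FreeMonoid.lift f y) : Q.HK →* M :=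
  Con.lift _ (FreeMonoid.lift f) (Con.conGen_le.2 hf)

@[simp]
theorem lift_gen {V M : Type} [Monoid M] (Q : HKGraph V) (f : V → M)
    (hf : ∀ x y, Q.Rel x y → FreeMonoid.lift f x = FreeMonoid.lift f y) (i : V) :
    Q.lift f hf (Q.gen i) = f i := by
  simp [lift, gen]

theorem induction_right {V : Type} (Q : HKGraph V) {p : Q.HK → Prop} (one : p 1)
    (mul_gen : ∀ x i, p x → p (x * Q.gen i)) (x : Q.HK) : p x := by
  obtain ⟨w, rfl⟩ := Con.mk'_surjective x
  obtain ⟨l, rfl⟩ := FreeMonoid.ofList.surjective w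
  induction l using List.reverseRecOn with
  | nil => exact one
  | append_singleton l i ih => exact mul_gen _ i ih

theorem induction_left {V : Type} (Q : HKGraph V) {p : Q.HK → Prop} (one : p 1)
    (gen_mul : ∀ i x, p x → p (Q.gen i * x)) (x : Q.HK) : p x := by
  obtain ⟨w, rfl⟩ := Con.mk'_surjective x
  obtain ⟨l, rfl⟩ := FreeMonoid.ofList.surjective w
  induction l with
  | nil => exact one
  | cons i l ih => exact gen_mul i _ ih

/-- The canonical map from the monoid of the digraph with a vertex deleted. -/
def incl {V : Type} (Q : HKGraph V) (a : V) : (Q.delete a).HK →* Q.HK :=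
  (Q.delete a).lift (fun i => Q.gen i.1) (by
    rintro _ _ (⟨i⟩ | ⟨i, j, h, he, h₁, h₂⟩ | ⟨i, j, h⟩ | ⟨i, j, h⟩ | ⟨i, j, h⟩) <;>
      simp only [map_mul, lift_eval_of]
    · exact Q.gen_mul_self _
    · exact Q.gen_comm (fun e => h (Subtype.ext e)) he h₁ h₂
    · exact Q.gen_braid h
    · exact Q.gen_arrow_left h
    · exact Q.gen_arrow_right h)

open Classical in
/-- The retraction onto the monoid of the digraph with a vertex deleted, sending the generator
of that vertex to `1`. -/
noncomputable def retract {V : Type} (Q : HKGraph V) (a : V) : Q.HK →* (Q.delete a).HK :=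
  Q.lift (fun i => if h : i ≠ a then (Q.delete a).gen ⟨i, h⟩ else 1) (by
    rintro _ _ (⟨i⟩ | ⟨i, j, h, he, h₁, h₂⟩ | ⟨i, j, h⟩ | ⟨i, j, h⟩ | ⟨i, j, h⟩) <;>
      simp only [map_mul, lift_eval_of]
    · by_cases hi : i = a
      · simp [hi]
      · simp only [ne_eq, hi, not_false_eq_true, dite_true, gen_mul_self]
    all_goals
      by_cases hi : i = a <;> by_cases hj : j = a <;>
        simp only [hi, hj, ne_eq, not_true, not_false_eq_true, dite_true, dite_false, one_mul,
          mul_one, gen_mul_self]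
    · exact gen_comm _ (fun e => h (congrArg Subtype.val e)) he h₁ h₂
    · exact gen_braid _ h
    · exact gen_arrow_left _ h
    · exact gen_arrow_right _ h)

theorem retract_surjective {V : Type} (Q : HKGraph V) (a : V) :
    Function.Surjective (Q.retract a) := by
  intro x
  induction x using induction_right with
  | one => exact ⟨1, map_one _⟩
  | mul_gen x i ih =>
    obtain ⟨y, rfl⟩ := ih
    exact ⟨y * Q.gen i.1, by simp [retract, i.2]⟩

theorem gen_mul_mul_gen_of_source {V : Type} (Q : HKGraph V) {a : V}
    (he : ∀ j, ¬ Q.edge a j) (hs : ∀ j, ¬ Q.arrow j a) (x : Q.HK) :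
    Q.gen a * x * Q.gen a = Q.gen a * x := by
  have key (j : V) : Q.gen a * Q.gen j * Q.gen a = Q.gen a * Q.gen j := by
    by_cases haj : a = j
    · subst haj; simp only [gen_mul_self]
    by_cases h : Q.arrow a j
    · exact (Q.gen_arrow_left h).symm
    · rw [mul_assoc, ← Q.gen_comm haj (he j) h (hs j), ← mul_assoc, gen_mul_self]
  induction x using induction_right with
  | one => simp [gen_mul_self]
  | mul_gen x j ih =>
    calc Q.gen a * (x * Q.gen j) * Q.gen a
        = Q.gen a * x * Q.gen a * Q.gen j * Q.gen a := by rw [ih]; simp only [mul_assoc]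
      _ = Q.gen a * x * (Q.gen a * Q.gen j * Q.gen a) := by simp only [mul_assoc]
      _ = Q.gen a * x * Q.gen a * Q.gen j := by rw [key]; simp only [mul_assoc]
      _ = Q.gen a * (x * Q.gen j) := by rw [ih, mul_assoc]

theorem gen_mul_mul_gen_of_sink {V : Type} (Q : HKGraph V) {a : V}
    (he : ∀ j, ¬ Q.edge a j) (hs : ∀ j, ¬ Q.arrow a j) (x : Q.HK) :
    Q.gen a * x * Q.gen a = x * Q.gen a := by
  have key (j : V) : Q.gen a * Q.gen j * Q.gen a = Q.gen j * Q.gen a := by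
    by_cases haj : a = j
    · subst haj; simp only [gen_mul_self]
    by_cases h : Q.arrow j a
    · exact (Q.gen_arrow_right h).symm
    · rw [Q.gen_comm haj (he j) (hs j) h, mul_assoc, gen_mul_self]
  induction x using induction_left with
  | one => simp [gen_mul_self]
  | gen_mul j x ih =>
    calc Q.gen a * (Q.gen j * x) * Q.gen a
        = Q.gen a * Q.gen j * (x * Q.gen a) := by simp only [mul_assoc]
      _ = Q.gen a * Q.gen j * Q.gen a * (x * Q.gen a) := by
        rw [← ih]; simp only [← mul_assoc]; simp only [mul_assoc, gen_mul_self, key]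
      _ = Q.gen j * (Q.gen a * x * Q.gen a) := by rw [key]; simp only [mul_assoc]
      _ = Q.gen j * x * Q.gen a := by rw [ih, mul_assoc]

/-- If a word needs the letter `a` at most once, every element lies in the image of `incl`
or is a product of two such elements with `gen a` in between. -/
theorem mem_range_incl_or_exists {V : Type} (Q : HKGraph V) {a : V}
    (h : (∀ x, Q.gen a * x * Q.gen a = Q.gen a * x) ∨
      (∀ x, Q.gen a * x * Q.gen a = x * Q.gen a)) (x : Q.HK) :
    (∃ u, Q.incl a u = x) ∨ ∃ u w, Q.incl a u * Q.gen a * Q.incl a w = x := by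
  induction x using induction_right with
  | one => exact .inl ⟨1, map_one _⟩
  | mul_gen x j ih =>
    by_cases hj : j = a
    · subst hj
      obtain ⟨u, rfl⟩ | ⟨u, w, rfl⟩ := ih
      · exact .inr ⟨u, 1, by simp⟩
      · obtain h | h := h
        · exact .inr ⟨u, w, by rw [mul_assoc, ← h]; simp only [mul_assoc, gen_mul_self]⟩
        · refine .inr ⟨u * w, 1, ?_⟩
          simp only [map_mul, map_one, mul_one]
          rw [mul_assoc, ← h]
          simp only [mul_assoc]
    · have hg : Q.gen j = Q.incl a ((Q.delete a).gen ⟨j, hj⟩) := by simp [incl]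
      obtain ⟨u, rfl⟩ | ⟨u, w, rfl⟩ := ih
      · exact .inl ⟨u * (Q.delete a).gen ⟨j, hj⟩, by rw [map_mul, hg]⟩
      · exact .inr ⟨u, w * (Q.delete a).gen ⟨j, hj⟩, 
          by rw [map_mul, hg, mul_assoc _ (Q.incl a w)]⟩

end HKGraph

/-- Deleting a source or a sink vertex does not affect finiteness of the
Hecke–Kiselman monoid. -/
theorem hk_delete_source_or_sink {V : Type} (Q : HKGraph V) (a : V)
    (h : ((∀ j, ¬ Q.edge a j) ∧ (∀ j, ¬ Q.arrow j a)) ∨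
         ((∀ j, ¬ Q.edge a j) ∧ (∀ j, ¬ Q.arrow a j))) :
    Finite Q.HK ↔ Finite (Q.delete a).HK := by
  refine ⟨fun _ => .of_surjective _ (Q.retract_surjective a), fun _ => ?_⟩
  have h' := h.imp (fun h => Q.gen_mul_mul_gen_of_source h.1 h.2)
    (fun h => Q.gen_mul_mul_gen_of_sink h.1 h.2)
  refine .of_surjective (Sum.elim (Q.incl a)
    (fun p : (Q.delete a).HK × (Q.delete a).HK => Q.incl a p.1 * Q.gen a * Q.incl a p.2))
    fun x => ?_
  obtain ⟨u, hu⟩ | ⟨u, w, hw⟩ := Q.mem_range_incl_or_exists h' x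
  · exact ⟨.inl u, hu⟩
  · exact ⟨.inr (u, w), hw⟩
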